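/- arXiv:1604.05504 — 2 statements merged into one kernel-verified Lean document; each statement's English description precedes it below -/
import Mathlib

section
/- Let G₁,…,Gₙ be finite groups with orders m₁,…,mₙ. The kernel of the canonical surjection from the free product G₁ * ⋯ * Gₙ onto the direct product G₁ × ⋯ × Gₙ is a free group of rank (n-1)·∏ᵢ mᵢ − Σᵢ ∏_{j≠i} mⱼ + 1. -/
open Monoid

namespace NielsenKer

open Classical in
/-- Edge labels of the Bass-Serre style graph that lie outside the spanning tree. -/
abbrev B {n : ℕ} (G : Fin n → Type) [∀ i, Group (G i)] : Type :=
  {q : Fin n × (∀ i, G i) // q.2 q.1 ≠ 1 ∧ ∃ j, j < q.1 ∧ q.2 j ≠ 1}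

variable {n : ℕ} {G : Fin n → Type} [∀ i, Group (G i)]

open Classical in
/-- The label of the edge `(i, x)`. -/
noncomputable def e (i : Fin n) (x : ∀ i, G i) : FreeGroup (B G) :=
  if h : x i ≠ 1 ∧ ∃ j, j < i ∧ x j ≠ 1 then FreeGroup.of ⟨(i, x), h⟩ else 1

/-- Action of `G i` on the covering space. -/
noncomputable def act (i : Fin n) :
    G i →* Equiv.Perm ((∀ i, G i) × FreeGroup (B G)) :=
  MonoidHom.toHomPerm
  { toFun := fun g y => (Pi.mulSingle i g * y.1, e i (Pi.mulSingle i g * y.1) * (e i y.1)⁻¹ * y.2)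
    map_one' := by
      funext y
      change _ = y
      simp
    map_mul' := by
      intro g h
      funext y
      refine Prod.ext ?_ ?_
      · change _ = Pi.mulSingle i g * (Pi.mulSingle i h * y.1)
        simp [Pi.mulSingle_mul, mul_assoc]
      · change _ = e i (Pi.mulSingle i g * (Pi.mulSingle i h * y.1)) *
          (e i (Pi.mulSingle i h * y.1))⁻¹ * (e i (Pi.mulSingle i h * y.1) * (e i y.1)⁻¹ * y.2)
        simp [Pi.mulSingle_mul, mul_assoc] }

theorem act_apply (i : Fin n) (g : G i) (y : (∀ i, G i) × FreeGroup (B G)) :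
    act i g y =
      (Pi.mulSingle i g * y.1, e i (Pi.mulSingle i g * y.1) * (e i y.1)⁻¹ * y.2) := rfl

noncomputable def Phi : CoprodI G →* Equiv.Perm ((∀ i, G i) × FreeGroup (B G)) :=
  CoprodI.lift act

theorem Phi_of (i : Fin n) (g : G i) (y : (∀ i, G i) × FreeGroup (B G)) :
    Phi (CoprodI.of g) y =
      (Pi.mulSingle i g * y.1, e i (Pi.mulSingle i g * y.1) * (e i y.1)⁻¹ * y.2) := by
  rw [Phi, CoprodI.lift_of, act_apply]

/-- the canonical map -/
def pr : CoprodI G →* (∀ i, G i) := CoprodI.lift (fun i => MonoidHom.mulSingle G i)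

theorem Phi_fst (g : CoprodI G) : ∀ y : (∀ i, G i) × FreeGroup (B G),
    (Phi g y).1 = pr g * y.1 := by
  induction g using CoprodI.induction_on with
  | one => simp
  | of i g => intro y; rw [Phi_of]; simp [pr]
  | mul g h hg hh => intro y; simp [hg, hh, mul_assoc]

theorem Phi_right (g : CoprodI G) : ∀ (x : ∀ i, G i) (a b : FreeGroup (B G)),
    Phi g (x, a * b) = ((Phi g (x, a)).1, (Phi g (x, a)).2 * b) := by
  induction g using CoprodI.induction_on with
  | one => simp
  | of i g => intro x a b; simp [Phi_of, mul_assoc]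
  | mul g h hg hh =>
    intro x a b
    simp only [map_mul, Equiv.Perm.mul_apply, hh, hg]

/-- tree section along a list -/
def sl (l : List (Fin n)) (x : ∀ i, G i) : CoprodI G :=
  (l.map (fun i => CoprodI.of (x i))).prod

def xl (l : List (Fin n)) (x : ∀ i, G i) : ∀ i, G i := fun j => if j ∈ l then x j else 1

theorem Phi_sl (x : ∀ i, G i) (l : List (Fin n)) (hl : l.Pairwise (· < ·)) :
    Phi (sl l x) (1, 1) = (xl l x, 1) := by
  induction l with
  | nil => simp [sl, xl]; rfl
  | cons i l ih =>
    rw [List.pairwise_cons] at hl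
    have h1 : sl (i :: l) x = CoprodI.of (x i) * sl l x := by simp [sl]
    have hi : i ∉ l := fun h => lt_irrefl _ (hl.1 i h)
    have h2 : Pi.mulSingle i (x i) * xl l x = xl (i :: l) x := by
      funext j
      by_cases hj : j = i
      · subst hj; simp [xl, hi]
      · simp [xl, hj]
    have h3 : ∀ l' : List (Fin n), (∀ j ∈ l', i ≤ j) → e i (xl l' x) = 1 := by
      intro l' hl'
      rw [e, dif_neg]
      rintro ⟨-, j, hj, hx⟩
      apply hx
      rw [xl, if_neg]
      intro hj'
      exact absurd (hl' j hj') (not_le.2 hj)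
    rw [h1, map_mul, Equiv.Perm.mul_apply, ih hl.2, Phi_of]
    simp only [h2]
    rw [h3 l (fun j hj => (hl.1 j hj).le), h3 (i :: l)]
    · simp
    · intro j hj
      rcases List.mem_cons.1 hj with rfl | hj
      · exact le_rfl
      · exact (hl.1 j hj).le

theorem sl_tree (x : ∀ i, G i) (i : Fin n) (hx : ∀ j, j < i → x j = 1)
    (l : List (Fin n)) (hl : l.Pairwise (· < ·)) (hi : i ∈ l) :
    sl l x = CoprodI.of (x i) * sl l (Function.update x i 1) := by
  induction l with
  | nil => simp at hi
  | cons k l ih =>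
    rw [List.pairwise_cons] at hl
    have h1 : ∀ y : ∀ i, G i, sl (k :: l) y = CoprodI.of (y k) * sl l y := by simp [sl]
    rw [h1, h1]
    rcases List.mem_cons.1 hi with rfl | hi
    · have : sl l (Function.update x i 1) = sl l x := by
        unfold sl
        congr 1
        apply List.map_congr_left
        intro j hj
        rw [Function.update_of_ne (hl.1 j hj).ne']
      simp [this]
    · have hk := hl.1 i hi
      rw [Function.update_of_ne hk.ne, hx k hk, ih hl.2 hi]
      simp

def s (x : ∀ i, G i) : CoprodI G := sl (List.finRange n) x

theorem Phi_s (x : ∀ i, G i) : Phi (s x) (1, 1) = (x, 1) := by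
  rw [s, Phi_sl _ _ (List.pairwise_lt_finRange n)]
  congr 1
  funext j
  simp [xl]

theorem pr_s (x : ∀ i, G i) : pr (s x) = x := by
  have := Phi_fst (s x) (1, 1)
  rw [Phi_s] at this
  simpa using this.symm

theorem s_one : s (1 : ∀ i, G i) = 1 := by
  simp [s, sl]

theorem s_tree (x : ∀ i, G i) (i : Fin n) (hx : ¬ (x i ≠ 1 ∧ ∃ j, j < i ∧ x j ≠ 1)) :
    s x = CoprodI.of (x i) * s (Function.update x i 1) := by
  by_cases h : x i = 1
  · have : Function.update x i 1 = x := by rw [← h]; simp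
    rw [this, h]; simp
  · apply sl_tree _ _ _ _ (List.pairwise_lt_finRange n) (List.mem_finRange i)
    intro j hj
    by_contra hne
    exact hx ⟨h, j, hj, hne⟩

theorem mulSingle_update (x : ∀ i, G i) (i : Fin n) :
    Pi.mulSingle i (x i) * Function.update x i 1 = x := by
  funext j
  by_cases hj : j = i
  · subst hj; simp
  · simp [hj]

theorem pr_of (i : Fin n) (g : G i) : pr (CoprodI.of g) = Pi.mulSingle i g := by
  simp [pr]

def gen (q : Fin n × (∀ i, G i)) : CoprodI G :=
  (s q.2)⁻¹ * (CoprodI.of (q.2 q.1) * s (Function.update q.2 q.1 1))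

theorem gen_mem (q : Fin n × (∀ i, G i)) : gen q ∈ (pr : CoprodI G →* _).ker := by
  rw [MonoidHom.mem_ker, gen, map_mul, map_mul, map_inv, pr_s, pr_s, pr_of, mulSingle_update]
  simp

noncomputable def psi : FreeGroup (B G) →* (pr : CoprodI G →* (∀ i, G i)).ker :=
  FreeGroup.lift (fun b => ⟨gen b.1, gen_mem b.1⟩)

theorem psi_e (i : Fin n) (x : ∀ i, G i) : (psi (e i x) : CoprodI G) = gen (i, x) := by
  unfold e
  split_ifs with h
  · simp [psi]
  · simp only [map_one, Subgroup.coe_one, gen]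
    rw [← s_tree x i h]
    simp

noncomputable def Psi (y : (∀ i, G i) × FreeGroup (B G)) : CoprodI G := s y.1 * psi y.2

theorem Psi_equiv (g : CoprodI G) : ∀ y : (∀ i, G i) × FreeGroup (B G),
    Psi (Phi g y) = g * Psi y := by
  induction g using CoprodI.induction_on with
  | one => simp
  | of i g =>
    intro y
    obtain ⟨x, a⟩ := y
    rw [Phi_of]
    have hu : Function.update (Pi.mulSingle i g * x) i 1 = Function.update x i 1 := by
      funext j
      by_cases hj : j = i
      · subst hj; simp
      · simp [hj]
    simp only [Psi, map_mul, map_inv, Subgroup.coe_mul, Subgroup.coe_inv, psi_e, gen, hu]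
    simp only [Pi.mul_apply, Pi.mulSingle_eq_same, map_mul]
    group
  | mul g h hg hh => intro y; simp [hg, hh, mul_assoc]

noncomputable def phi : (pr : CoprodI G →* (∀ i, G i)).ker →* FreeGroup (B G) where
  toFun k := (Phi k.1 (1, 1)).2
  map_one' := by simp
  map_mul' := by
    intro k l
    have h : Phi l.1 (1, 1) = (1, 1 * (Phi l.1 (1, 1)).2) := by
      ext1
      · rw [Phi_fst, MonoidHom.mem_ker.1 l.2]; simp
      · simp
    rw [Subgroup.coe_mul, map_mul, Equiv.Perm.mul_apply, h, Phi_right]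
    simp

theorem Phi_ker (k : (pr : CoprodI G →* (∀ i, G i)).ker) : Phi k.1 (1, 1) = (1, phi k) := by
  ext1
  · rw [Phi_fst, MonoidHom.mem_ker.1 k.2]; simp
  · rfl

theorem psi_phi (k : (pr : CoprodI G →* (∀ i, G i)).ker) : psi (phi k) = k := by
  have h := Psi_equiv k.1 (1, 1)
  rw [Phi_ker] at h
  simp only [Psi, s_one, map_one, Subgroup.coe_one, one_mul, mul_one] at h
  exact Subtype.ext h

theorem phi_gen (b : B G) : phi ⟨gen b.1, gen_mem b.1⟩ = FreeGroup.of b := by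
  obtain ⟨⟨i, x⟩, h⟩ := b
  have h0 : e i (Function.update x i 1) = 1 := by
    rw [e, dif_neg]; simp
  have h1 : e i x = FreeGroup.of ⟨(i, x), h⟩ := by rw [e, dif_pos h]
  have key : Phi (CoprodI.of (x i) * s (Function.update x i 1)) (1, 1) = (x, e i x) := by
    rw [map_mul, Equiv.Perm.mul_apply, Phi_s, Phi_of]
    simp only [mulSingle_update, h0]
    simp
  have k2 : Phi (s x) (1, e i x) = (x, e i x) := by
    have := Phi_right (s x) 1 1 (e i x)
    rw [Phi_s] at this
    simpa using this
  change (Phi (gen (i, x)) (1, 1)).2 = _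
  rw [gen, map_mul, Equiv.Perm.mul_apply, key, ← k2, map_inv]
  change ((Phi (s x))⁻¹ (Phi (s x) (1, e i x))).2 = _
  rw [← Equiv.Perm.mul_apply, inv_mul_cancel, Equiv.Perm.one_apply, h1]

theorem phi_psi : phi.comp psi = MonoidHom.id (FreeGroup (B G)) := by
  apply FreeGroup.ext_hom
  intro b
  simp only [MonoidHom.comp_apply, psi, FreeGroup.lift_apply_of, MonoidHom.id_apply]
  exact phi_gen b

noncomputable def kerEquiv : (pr : CoprodI G →* (∀ i, G i)).ker ≃* FreeGroup (B G) :=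
  MonoidHom.toMulEquiv phi psi (MonoidHom.ext psi_phi) phi_psi

open Classical in
theorem card_fix [∀ i, Fintype (G i)] (i : Fin n) :
    (∑ x : ∀ i, G i, if x i = 1 then (1 : ℤ) else 0)
      = ∏ j ∈ Finset.univ.erase i, (Fintype.card (G j) : ℤ) := by
  have h : (Finset.univ.filter fun x : ∀ i, G i => x i = 1)
      = Fintype.piFinset (fun j => if j = i then ({1} : Finset (G j)) else Finset.univ) := by
    ext x
    simp only [Finset.mem_filter, Finset.mem_univ, true_and, Fintype.mem_piFinset]
    constructor
    · intro hx j
      by_cases hj : j = i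
      · subst hj; simp [hx]
      · simp [hj]
    · intro hx
      simpa using hx i
  rw [← Finset.sum_filter, h, Finset.sum_const, nsmul_eq_mul, mul_one, Fintype.card_piFinset,
    ← Finset.mul_prod_erase _ _ (Finset.mem_univ i)]
  simp only [if_true, Finset.card_singleton, one_mul]
  push_cast
  apply Finset.prod_congr rfl
  intro j hj
  rw [if_neg (Finset.ne_of_mem_erase hj), Finset.card_univ]

open Classical in
theorem tree_sum (x : ∀ i, G i) :
    (∑ i : Fin n, if x i ≠ 1 ∧ ∀ j, j < i → x j = 1 then (1 : ℤ) else 0)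
      = 1 - if x = 1 then 1 else 0 := by
  by_cases hx : x = 1
  · simp [hx]
  · have hne : (Finset.univ.filter fun i => x i ≠ 1).Nonempty := by
      obtain ⟨i, hi⟩ := Function.ne_iff.1 hx
      exact ⟨i, by simpa using hi⟩
    have hm := Finset.min'_mem _ hne
    have hmin := fun j hj => Finset.min'_le (Finset.univ.filter fun i => x i ≠ 1) j hj
    set m := Finset.min' _ hne with hmdef
    have hm' : x m ≠ 1 := by simpa using hm
    have hmin' : ∀ j, j < m → x j = 1 := by
      intro j hj
      by_contra hne
      exact absurd (hmin j (by simpa using hne)) (not_le.2 hj)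
    rw [if_neg hx, Finset.sum_eq_single m]
    · rw [if_pos ⟨hm', hmin'⟩]; simp
    · intro i _ hi
      rw [if_neg]
      rintro ⟨h1, h2⟩
      rcases lt_trichotomy i m with h | h | h
      · exact h1 (hmin' i h)
      · exact hi h
      · exact hm' (h2 m h)
    · simp

open Classical in
theorem card_B [∀ i, Fintype (G i)] :
    (Fintype.card (B G) : ℤ) = ((n : ℤ) - 1) * ∏ i, (Fintype.card (G i) : ℤ)
          - ∑ i, ∏ j ∈ Finset.univ.erase i, (Fintype.card (G j) : ℤ) + 1 := by
  rw [Fintype.card_subtype, Finset.card_filter]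
  push_cast
  rw [Fintype.sum_prod_type]
  have h : ∀ (i : Fin n) (x : ∀ i, G i),
      (if x i ≠ 1 ∧ ∃ j, j < i ∧ x j ≠ 1 then (1 : ℤ) else 0)
      = 1 - (if x i = 1 then 1 else 0)
        - (if x i ≠ 1 ∧ ∀ j, j < i → x j = 1 then (1 : ℤ) else 0) := by
    intro i x
    by_cases h1 : x i = 1
    · simp [h1]
    · by_cases h2 : ∀ j, j < i → x j = 1
      · have : ¬ ∃ j, j < i ∧ x j ≠ 1 := by
          rintro ⟨j, hj, hne⟩; exact hne (h2 j hj)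
        rw [if_neg (fun h => this h.2), if_neg h1, if_pos ⟨h1, h2⟩]; norm_num
      · have : ∃ j, j < i ∧ x j ≠ 1 := by
          by_contra hc
          exact h2 fun j hj => by
            by_contra hne
            exact hc ⟨j, hj, hne⟩
        rw [if_pos ⟨h1, this⟩, if_neg h1, if_neg (fun h => h2 h.2)]; norm_num
  simp only [h, Finset.sum_sub_distrib, card_fix]
  rw [Finset.sum_comm (f := fun (i : Fin n) (x : ∀ i, G i) =>
    if x i ≠ 1 ∧ ∀ j, j < i → x j = 1 then (1 : ℤ) else 0)]
  simp only [tree_sum, Finset.sum_sub_distrib]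
  simp
  ring

end NielsenKer

/-- The kernel of the canonical surjection from the free product of finite
groups `G₁ * ⋯ * Gₙ` onto the direct product is a free group of rank
`(n-1)·∏ᵢ mᵢ − Σᵢ ∏_{j≠i} mⱼ + 1`, where `mᵢ = |Gᵢ|`. -/
theorem stmt0 (n : ℕ) (hn : 1 ≤ n) (G : Fin n → Type) [∀ i, Group (G i)]
    [∀ i, Fintype (G i)]
    (p : CoprodI G →* (∀ i, G i))
    (hp : p = CoprodI.lift (fun i => MonoidHom.mulSingle G i)) :
    ∃ r : ℕ,
      (r : ℤ) = ((n : ℤ) - 1) * ∏ i, (Fintype.card (G i) : ℤ)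
          - ∑ i, ∏ j ∈ Finset.univ.erase i, (Fintype.card (G j) : ℤ) + 1 ∧
      Nonempty (p.ker ≃* FreeGroup (Fin r)) := by
  classical
  subst hp
  exact ⟨Fintype.card (NielsenKer.B G), NielsenKer.card_B,
    ⟨NielsenKer.kerEquiv.trans
      (FreeGroup.freeGroupCongr (Fintype.equivFin (NielsenKer.B G)))⟩⟩
end

section
/- Let G₁ and G₂ be finite groups of orders m₁ and m₂. The kernel of the canonical surjection G₁ * G₂ → G₁ × G₂ is a free group of rank (m₁ − 1)(m₂ − 1). -/
namespace KerCoprod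
open Monoid.Coprod

variable (G₁ G₂ : Type) [Group G₁] [Group G₂]

/-- Index set of the free generators. -/
abbrev X := {a : G₁ // a ≠ 1} × {b : G₂ // b ≠ 1}

variable {G₁ G₂}

open Classical in
/-- The free generator attached to `(a, b)`, or `1` if `a = 1` or `b = 1`. -/
noncomputable def c (a : G₁) (b : G₂) : FreeGroup (X G₁ G₂) :=
  if h : a ≠ 1 ∧ b ≠ 1 then FreeGroup.of (⟨a, h.1⟩, ⟨b, h.2⟩) else 1

@[simp] lemma c_one_left (b : G₂) : c (1 : G₁) b = 1 := by simp [c]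
@[simp] lemma c_one_right (a : G₁) : c a (1 : G₂) = 1 := by simp [c]
lemma c_of (x : X G₁ G₂) : c x.1.1 x.2.1 = FreeGroup.of x := by
  simp [c, x.1.2, x.2.2]

/-- The set on which the free product acts from the right. -/
abbrev S (G₁ G₂ : Type) [Group G₁] [Group G₂] := FreeGroup (X G₁ G₂) × G₁ × G₂

/-- Right action of the first factor. -/
noncomputable def act1 : G₁ →* (Function.End (S G₁ G₂))ᵐᵒᵖ where
  toFun a' := MulOpposite.op
    (fun s : S G₁ G₂ => (s.1 * c s.2.1 s.2.2 * (c (s.2.1 * a') s.2.2)⁻¹, s.2.1 * a', s.2.2))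
  map_one' := by
    apply MulOpposite.unop_injective
    funext s
    simp
    rfl
  map_mul' x y := by
    apply MulOpposite.unop_injective
    funext s
    obtain ⟨f, a, b⟩ := s
    change (f * c a b * (c (a * (x * y)) b)⁻¹, a * (x * y), b) =
      (f * c a b * (c (a * x) b)⁻¹ * c (a * x) b * (c (a * x * y) b)⁻¹, a * x * y, b)
    simp [mul_assoc]

/-- Right action of the second factor. -/
noncomputable def act2 : G₂ →* (Function.End (S G₁ G₂))ᵐᵒᵖ where
  toFun b' := MulOpposite.op (fun s : S G₁ G₂ => (s.1, s.2.1, s.2.2 * b'))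
  map_one' := by
    apply MulOpposite.unop_injective
    funext s
    simp
    rfl
  map_mul' x y := by
    apply MulOpposite.unop_injective
    funext s
    obtain ⟨f, a, b⟩ := s
    change (f, a, b * (x * y)) = (f, a, b * x * y)
    rw [mul_assoc]

/-- The right action of the free product. -/
noncomputable def act (w : Monoid.Coprod G₁ G₂) (s : S G₁ G₂) : S G₁ G₂ :=
  (lift act1 act2 w).unop s

lemma act_mul (v w : Monoid.Coprod G₁ G₂) (s : S G₁ G₂) :
    act (v * w) s = act w (act v s) := by
  simp only [act, map_mul, MulOpposite.unop_mul]; rfl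

lemma act_one (s : S G₁ G₂) : act 1 s = s := by
  simp only [act, map_one]; rfl

lemma act_inl (a : G₁) (s : S G₁ G₂) : act (inl a) s =
    (s.1 * c s.2.1 s.2.2 * (c (s.2.1 * a) s.2.2)⁻¹, s.2.1 * a, s.2.2) := rfl

lemma act_inr (b : G₂) (s : S G₁ G₂) : act (inr b) s = (s.1, s.2.1, s.2.2 * b) := rfl

/-- The map from the free group to the free product. -/
noncomputable def phi : FreeGroup (X G₁ G₂) →* Monoid.Coprod G₁ G₂ :=
  FreeGroup.lift fun x => inl x.1.1 * inr x.2.1 * (inl x.1.1)⁻¹ * (inr x.2.1)⁻¹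

lemma phi_c (a : G₁) (b : G₂) :
    phi (c a b) = inl a * inr b * (inl a)⁻¹ * (inr b)⁻¹ := by
  by_cases ha : a = 1
  · subst ha; simp
  by_cases hb : b = 1
  · subst hb; simp
  have := c_of (⟨a, ha⟩, ⟨b, hb⟩)
  simp only at this
  rw [this]
  simp [phi]

/-- The evaluation map. -/
noncomputable def theta (s : S G₁ G₂) : Monoid.Coprod G₁ G₂ :=
  phi s.1 * inl s.2.1 * inr s.2.2

lemma theta_act (w : Monoid.Coprod G₁ G₂) :
    ∀ s : S G₁ G₂, theta (act w s) = theta s * w := by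
  induction w using Monoid.Coprod.induction_on with
  | inl a =>
    intro s
    rw [act_inl]
    simp only [theta, map_mul, map_inv, phi_c]
    group
  | inr b =>
    intro s
    rw [act_inr]
    simp only [theta, map_mul, mul_assoc]
  | mul x y hx hy =>
    intro s
    rw [act_mul, hy, hx, mul_assoc]

lemma act_phi_of (x : X G₁ G₂) (f : FreeGroup (X G₁ G₂)) :
    act (phi (FreeGroup.of x)) (f, 1, 1) = (f * FreeGroup.of x, 1, 1) := by
  rw [← c_of, phi_c, ← map_inv, ← map_inv]
  simp only [act_mul, act_inl, act_inr]
  simp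

lemma act_phi (g : FreeGroup (X G₁ G₂)) :
    ∀ f : FreeGroup (X G₁ G₂), act (phi g) (f, 1, 1) = (f * g, 1, 1) := by
  induction g using FreeGroup.induction_on with
  | C1 => intro f; simp [act_one]
  | of x => exact act_phi_of x
  | inv_of x h =>
    intro f
    have := act_phi_of x (f * (FreeGroup.of x)⁻¹)
    rw [inv_mul_cancel_right] at this
    conv_lhs => rw [← this]
    rw [← act_mul, ← map_mul]
    simp [act_one]
  | mul x y hx hy =>
    intro f
    rw [map_mul, act_mul, hx, hy, mul_assoc]

lemma phi_injective : Function.Injective (phi : FreeGroup (X G₁ G₂) → _) := by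
  intro f g h
  have h1 := act_phi f 1
  rw [h, act_phi g 1] at h1
  simpa using h1.symm

lemma range_phi : (phi : FreeGroup (X G₁ G₂) →* _).range =
    (lift (MonoidHom.inl G₁ G₂) (MonoidHom.inr G₁ G₂)).ker := by
  have hle : ∀ f : FreeGroup (X G₁ G₂),
      lift (MonoidHom.inl G₁ G₂) (MonoidHom.inr G₁ G₂) (phi f) = 1 := by
    have : (lift (MonoidHom.inl G₁ G₂) (MonoidHom.inr G₁ G₂)).comp phi = 1 := by
      ext x <;> simp [phi]
    intro f
    exact DFunLike.congr_fun this f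
  ext w
  rw [MonoidHom.mem_ker]
  constructor
  · rintro ⟨f, rfl⟩
    exact hle f
  · intro hw
    have h := theta_act w (1, 1, 1)
    generalize act w ((1, 1, 1) : S G₁ G₂) = t at h
    obtain ⟨f, a, b⟩ := t
    simp only [theta, map_one, one_mul] at h
    rw [← h] at hw
    simp only [map_mul, hle, lift_apply_inl, lift_apply_inr, one_mul] at hw
    have ha : a = 1 := by simpa using congrArg Prod.fst hw
    have hb : b = 1 := by simpa using congrArg Prod.snd hw
    subst ha hb
    exact ⟨f, by simpa using h⟩

end KerCoprod

/-- The kernel of the canonical surjection `G₁ * G₂ → G₁ × G₂` is a free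
group of rank `(m₁ − 1)(m₂ − 1)` where `mᵢ = |Gᵢ|`. -/
theorem stmt1 (G₁ G₂ : Type) [Group G₁] [Group G₂] [Fintype G₁] [Fintype G₂]
    (p : Monoid.Coprod G₁ G₂ →* G₁ × G₂)
    (hp : p = Monoid.Coprod.lift (MonoidHom.inl G₁ G₂) (MonoidHom.inr G₁ G₂)) :
    Nonempty (p.ker ≃* FreeGroup
      (Fin ((Fintype.card G₁ - 1) * (Fintype.card G₂ - 1)))) := by
  classical
  subst hp
  rw [← KerCoprod.range_phi]
  refine ⟨(MonoidHom.ofInjective KerCoprod.phi_injective).symm.trans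
    (FreeGroup.freeGroupCongr (Fintype.equivFinOfCardEq ?_))⟩
  rw [Fintype.card_prod]
  simp [Fintype.card_subtype_compl]
end
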